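/- Assume (for given n) that [B_δ, B_{kδ}] = 0 for all k < n. Then for all m ≤ n and all r ≥ 0, the q^{-2}-commutator of real root vectors satisfies [B_{rδ+α_1}, B_{(r+m)δ+α_1}]_{q^{-2}} = −B_{mδ} − (q^{-2}−1)Σ_{p=1}^{⌊(m−1)/2⌋} q^{−2(p−1)}B_{(m−2p)δ} + (q^{-2}−1)Σ_{p=1}^{⌊m/2⌋} a_p^m B_{(m−p+r)δ+α_1}B_{(p+r)δ+α_1}, where a_p^m = q^{−2(p−1)}(1+q^{−2}) for p ≤ ⌊(m−1)/2⌋ and a_{m/2}^m = q^{−m+2} for even m, and [x,y]_{q^{-2}} = xy − q^{-2}yx. -/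

import Mathlib

set_option synthInstance.maxHeartbeats 1000000
set_option maxHeartbeats 1000000

noncomputable section

open scoped BigOperators

/-- The field `ℚ(q)` of rational functions. -/
abbrev KK : Type := RatFunc ℚ

/-- The indeterminate `q ∈ ℚ(q)`. -/
def qq : KK := RatFunc.X

/-- The `q`-Dolan–Grady relations defining the `q`-Onsager algebra `B_c`:
`Σᵢ (−1)ⁱ [3 choose i]_q B₀^{3−i} B₁ B₀^i = −qc(q+q⁻¹)²(B₀B₁ − B₁B₀)` and the
same with `B₀, B₁` interchanged (here `[3 choose 1]_q = [3 choose 2]_q = q² + 1 + q⁻²`). -/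
inductive qOnsRel (c : KK) : FreeAlgebra KK (Fin 2) → FreeAlgebra KK (Fin 2) → Prop
  | r0 : qOnsRel c
      (FreeAlgebra.ι KK (0 : Fin 2) ^ 3 * FreeAlgebra.ι KK (1 : Fin 2)
        - (qq ^ 2 + 1 + (qq⁻¹) ^ 2) • (FreeAlgebra.ι KK (0 : Fin 2) ^ 2 * FreeAlgebra.ι KK (1 : Fin 2) * FreeAlgebra.ι KK (0 : Fin 2))
        + (qq ^ 2 + 1 + (qq⁻¹) ^ 2) • (FreeAlgebra.ι KK (0 : Fin 2) * FreeAlgebra.ι KK (1 : Fin 2) * FreeAlgebra.ι KK (0 : Fin 2) ^ 2)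
        - FreeAlgebra.ι KK (1 : Fin 2) * FreeAlgebra.ι KK (0 : Fin 2) ^ 3)
      ((-(qq * c * (qq + qq⁻¹) ^ 2)) •
        (FreeAlgebra.ι KK (0 : Fin 2) * FreeAlgebra.ι KK (1 : Fin 2) - FreeAlgebra.ι KK (1 : Fin 2) * FreeAlgebra.ι KK (0 : Fin 2)))
  | r1 : qOnsRel c
      (FreeAlgebra.ι KK (1 : Fin 2) ^ 3 * FreeAlgebra.ι KK (0 : Fin 2)
        - (qq ^ 2 + 1 + (qq⁻¹) ^ 2) • (FreeAlgebra.ι KK (1 : Fin 2) ^ 2 * FreeAlgebra.ι KK (0 : Fin 2) * FreeAlgebra.ι KK (1 : Fin 2))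
        + (qq ^ 2 + 1 + (qq⁻¹) ^ 2) • (FreeAlgebra.ι KK (1 : Fin 2) * FreeAlgebra.ι KK (0 : Fin 2) * FreeAlgebra.ι KK (1 : Fin 2) ^ 2)
        - FreeAlgebra.ι KK (0 : Fin 2) * FreeAlgebra.ι KK (1 : Fin 2) ^ 3)
      ((-(qq * c * (qq + qq⁻¹) ^ 2)) •
        (FreeAlgebra.ι KK (1 : Fin 2) * FreeAlgebra.ι KK (0 : Fin 2) - FreeAlgebra.ι KK (0 : Fin 2) * FreeAlgebra.ι KK (1 : Fin 2)))

/-- The `q`-Onsager algebra `B_c`. -/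
abbrev QOns (c : KK) : Type := RingQuot (qOnsRel c)

/-- The generator `B₀` of `B_c`. -/
def Bo (c : KK) : QOns c := RingQuot.mkAlgHom KK (qOnsRel c) (FreeAlgebra.ι KK (0 : Fin 2))

/-- The generator `B₁` of `B_c`. -/
def Bi (c : KK) : QOns c := RingQuot.mkAlgHom KK (qOnsRel c) (FreeAlgebra.ι KK (1 : Fin 2))

/-- `B_δ = −B₀B₁ + q⁻²B₁B₀`. -/
def Bdel (c : KK) : QOns c := -(Bo c * Bi c) + ((qq⁻¹) ^ 2) • (Bi c * Bo c)

/-- `B̃_δ = −B₁B₀ + q⁻²B₀B₁`. -/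
def tBdel (c : KK) : QOns c := -(Bi c * Bo c) + ((qq⁻¹) ^ 2) • (Bo c * Bi c)

/-- The formula for `T₀(B₁)`:
`(1/(q²[2]_q c))(B₁B₀² − q[2]_q B₀B₁B₀ + q²B₀²B₁) + B₁`. -/
def T0B1val (c : KK) : QOns c :=
  (qq ^ 2 * (qq + qq⁻¹) * c)⁻¹ •
    (Bi c * Bo c ^ 2 - (qq * (qq + qq⁻¹)) • (Bo c * Bi c * Bo c) + qq ^ 2 • (Bo c ^ 2 * Bi c))
    + Bi c

/-- The formula for `T₀⁻¹(B₁)`: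
`(1/(q²[2]_q c))(B₀²B₁ − q[2]_q B₀B₁B₀ + q²B₁B₀²) + B₁`. -/
def T0invB1val (c : KK) : QOns c :=
  (qq ^ 2 * (qq + qq⁻¹) * c)⁻¹ •
    (Bo c ^ 2 * Bi c - (qq * (qq + qq⁻¹)) • (Bo c * Bi c * Bo c) + qq ^ 2 • (Bi c * Bo c ^ 2))
    + Bi c

/-- `T₁ = Φ ∘ T₀ ∘ Φ`. -/
def T1def (c : KK) (Φ T0 : QOns c ≃ₐ[KK] QOns c) : QOns c ≃ₐ[KK] QOns c :=
  Φ.trans (T0.trans Φ)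

/-- The real root vectors `B_{nδ+α₀} = (T₀Φ)ⁿ(B₀)` for `n ≥ 0`. -/
def Ba0 (c : KK) (Φ T0 : QOns c ≃ₐ[KK] QOns c) (n : ℕ) : QOns c :=
  ((⇑T0 ∘ ⇑Φ)^[n]) (Bo c)

/-- The real root vectors `B_{nδ+α₁} = (T₁⁻¹Φ)ⁿ(B₁)` for `n ≥ 0`. -/
def Ba1 (c : KK) (Φ T0 : QOns c ≃ₐ[KK] QOns c) (n : ℕ) : QOns c :=
  ((⇑(T1def c Φ T0).symm ∘ ⇑Φ)^[n]) (Bi c)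

/-- `B_{kδ+α₁}` for `k ∈ ℤ`, with the convention `B_{kδ+α₁} = B_{(−k−1)δ+α₀}` for `k < 0`. -/
def Ba1Z (c : KK) (Φ T0 : QOns c ≃ₐ[KK] QOns c) (k : ℤ) : QOns c :=
  if 0 ≤ k then Ba1 c Φ T0 k.toNat else Ba0 c Φ T0 (-k - 1).toNat

/-- `B_{kδ+α₀}` for `k ∈ ℤ`, with the convention `B_{kδ+α₀} = B_{(−k−1)δ+α₁}` for `k < 0`. -/
def Ba0Z (c : KK) (Φ T0 : QOns c ≃ₐ[KK] QOns c) (k : ℤ) : QOns c :=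
  if 0 ≤ k then Ba0 c Φ T0 k.toNat else Ba1 c Φ T0 (-k - 1).toNat

/-- `C_m = Σ_{p=0}^{m−2} B_{pδ+α₁} B_{(m−p−2)δ+α₁}` (so `C₀ = C₁ = 0`). -/
def CC (c : KK) (Φ T0 : QOns c ≃ₐ[KK] QOns c) (m : ℕ) : QOns c :=
  ∑ p ∈ Finset.range (m - 1), Ba1 c Φ T0 p * Ba1 c Φ T0 (m - 2 - p)

/-- The imaginary root vectors
`B_{mδ} = −B₀B_{(m−1)δ+α₁} + q⁻²B_{(m−1)δ+α₁}B₀ + (q⁻²−1)C_m` for `m ≥ 1`. -/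
def Bim (c : KK) (Φ T0 : QOns c ≃ₐ[KK] QOns c) (m : ℕ) : QOns c :=
  -(Bo c * Ba1 c Φ T0 (m - 1)) + ((qq⁻¹) ^ 2) • (Ba1 c Φ T0 (m - 1) * Bo c)
    + (((qq⁻¹) ^ 2 - 1)) • CC c Φ T0 m


section Abstract

variable {K R : Type*} [Field K] [Ring R] [Algebra K R]

/-- The quadratic part of the commutator formula, defined recursively. -/
def auxQ (v : K) (A : ℕ → R) : ℕ → ℕ → R
  | 0, r => -(A r * A r)
  | 1, _ => 0
  | (m + 2), r => (1 + v) • (A (r + m + 1) * A (r + 1)) + v • auxQ v A m (r + 1)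

/-- The linear tail of imaginary root vectors, defined recursively. -/
def auxU (v : K) (B : ℕ → R) : ℕ → R
  | 0 => 0
  | 1 => 0
  | 2 => 0
  | (m + 3) => B (m + 1) + v • auxU v B (m + 1)

/-- The full linear part. -/
def auxS (v : K) (B : ℕ → R) : ℕ → R
  | 0 => 0
  | (m + 1) => B (m + 1) + (v - 1) • auxU v B (m + 1)

/-- The shifted symmetric sums. -/
def auxC (A : ℕ → R) : ℕ → ℕ → R
  | 0, _ => 0
  | 1, _ => 0
  | 2, r => A (r + 1) * A (r + 1)
  | (m + 3), r => A (r + 1) * A (r + m + 2) + A (r + m + 2) * A (r + 1) + auxC A (m + 1) (r + 1)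

theorem auxC_eq_sum (A : ℕ → R) : ∀ m r, auxC A m r =
    ∑ p ∈ Finset.range (m - 1), A (r + p + 1) * A (r + (m - 2 - p) + 1)
  | 0, r => by simp [auxC]
  | 1, r => by simp [auxC]
  | 2, r => by simp [auxC]
  | (m + 3), r => by
    rw [auxC, auxC_eq_sum A (m + 1) (r + 1)]
    have e : m + 3 - 1 = (m + 1) + 1 := by omega
    rw [e, Finset.sum_range_succ, Finset.sum_range_succ']
    have e2 : m + 1 - 1 = m := by omega
    rw [e2]
    have : ∀ p ∈ Finset.range m, A (r + 1 + p + 1) * A (r + 1 + (m + 1 - 2 - p) + 1) =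
        A (r + (p + 1) + 1) * A (r + (m + 3 - 2 - (p + 1)) + 1) := by
      intro p hp
      rw [Finset.mem_range] at hp
      have h1 : r + 1 + p + 1 = r + (p + 1) + 1 := by omega
      have h2 : r + 1 + (m + 1 - 2 - p) + 1 = r + (m + 3 - 2 - (p + 1)) + 1 := by omega
      rw [h1, h2]
    rw [Finset.sum_congr rfl this]
    have h3 : r + (m + 3 - 2 - 0) + 1 = r + m + 2 := by omega
    have h4 : r + (m + 3 - 2 - (m + 1)) + 1 = r + 1 := by omega
    have h5 : r + (m + 1) + 1 = r + m + 2 := by omega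
    rw [h3, h4, h5]
    simp only [add_zero]
    abel

theorem auxU_eq_sum (v : K) (B : ℕ → R) : ∀ m, auxU v B m =
    ∑ p ∈ Finset.range ((m - 1) / 2), v ^ p • B (m - 2 * (p + 1))
  | 0 => by simp [auxU]
  | 1 => by simp [auxU]
  | 2 => by simp [auxU]
  | (m + 3) => by
    rw [auxU, auxU_eq_sum v B (m + 1)]
    have e : (m + 3 - 1) / 2 = (m + 1 - 1) / 2 + 1 := by omega
    rw [e, Finset.sum_range_succ', Finset.smul_sum]
    have h0 : m + 3 - 2 * (0 + 1) = m + 1 := by omega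
    rw [h0, pow_zero, one_smul, add_comm]
    congr 1
    apply Finset.sum_congr rfl
    intro p _
    have h1 : m + 3 - 2 * (p + 1 + 1) = m + 1 - 2 * (p + 1) := by omega
    rw [h1, smul_smul, pow_succ']

theorem auxQ_eq_sum (v : K) (A : ℕ → R) : ∀ m r, 1 ≤ m → auxQ v A m r =
    ∑ p ∈ Finset.range (m / 2), (if 2 * (p + 1) = m then v ^ p else v ^ p * (1 + v)) •
      (A (m - (p + 1) + r) * A (p + 1 + r))
  | 0, r => by simp
  | 1, r => by simp [auxQ]
  | 2, r => by
    intro _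
    simp [auxQ, add_comm]
    module
  | (m + 3), r => by
    intro _
    rw [auxQ, auxQ_eq_sum v A (m + 1) (r + 1) (by omega)]
    have e : (m + 3) / 2 = (m + 1) / 2 + 1 := by omega
    rw [e, Finset.sum_range_succ', Finset.smul_sum]
    have h0 : ¬ (2 * (0 + 1) = m + 3) := by omega
    have h1 : m + 3 - (0 + 1) + r = r + (m + 1) + 1 := by omega
    have h2 : 0 + 1 + r = r + 1 := by omega
    rw [if_neg h0, h1, h2, pow_zero, one_mul, add_comm]
    congr 1
    apply Finset.sum_congr rfl
    intro p hp
    rw [Finset.mem_range] at hp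
    have h3 : m + 3 - (p + 1 + 1) + r = m + 1 - (p + 1) + (r + 1) := by omega
    have h4 : p + 1 + 1 + r = p + 1 + (r + 1) := by omega
    have h5 : (2 * (p + 1 + 1) = m + 3) ↔ (2 * (p + 1) = m + 1) := by omega
    rw [h3, h4, smul_smul]
    simp only [h5]
    split_ifs
    · rw [pow_succ']
    · rw [pow_succ', mul_assoc]

/-- Compatibility of the quadratic part with the derivation `[d, ·]`. -/
theorem auxQ_der (v κ : K) (A : ℕ → R) (d : R)
    (hd : ∀ r, d * A (r + 1) - A (r + 1) * d = κ • (A (r + 2) - A r))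
    (h1 : ∀ r, A r * A (r + 1) - v • (A (r + 1) * A r) = -d) :
    ∀ m r, d * auxQ v A (m + 1) (r + 1) - auxQ v A (m + 1) (r + 1) * d =
      κ • (auxQ v A (m + 2) (r + 1) - auxQ v A (m + 2) r
        + auxQ v A m (r + 2) - auxQ v A m (r + 1))
  | 0, r => by
    simp only [auxQ, add_zero, mul_zero, zero_mul, sub_zero]
    module
  | 1, r => by
    have hA := hd (r + 1)
    have a1 := h1 (r + 2)
    have a2 := h1 (r + 1)
    simp only [auxQ, add_assoc, Nat.reduceAdd] at hA a1 a2 ⊢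
    have key : d * (A (r + 2) * A (r + 2)) - A (r + 2) * A (r + 2) * d
      = (d * A (r + 2) - A (r + 2) * d) * A (r + 2)
        + A (r + 2) * (d * A (r + 2) - A (r + 2) * d) := by noncomm_ring
    have goal' : d * (A (r + 2) * A (r + 2)) - A (r + 2) * A (r + 2) * d =
      κ • ((1 + v) • (A (r + 3) * A (r + 2)) - (1 + v) • (A (r + 2) * A (r + 1))) := by
      rw [key, hA]
      simp only [smul_mul_assoc, mul_smul_comm, mul_sub, sub_mul]
      linear_combination (norm := module) κ • a1 - κ • a2
    simp only [mul_add, add_mul, mul_neg, neg_mul, smul_mul_assoc, mul_smul_comm]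
    linear_combination (norm := module) goal'
  | (m + 2), r => by
    have ih := auxQ_der v κ A d hd h1 m (r + 1)
    have hA : d * A (r + m + 3) - A (r + m + 3) * d = κ • (A (r + m + 4) - A (r + m + 2)) :=
      hd (r + m + 2)
    have hB : d * A (r + 2) - A (r + 2) * d = κ • (A (r + 3) - A (r + 1)) := hd (r + 1)
    have i1 : r + 1 + (m + 1) + 1 = r + m + 3 := by omega
    have i2 : r + 1 + (m + 2) + 1 = r + m + 4 := by omega
    have i3 : r + (m + 2) + 1 = r + m + 3 := by omega
    have i4 : r + 2 + m + 1 = r + m + 3 := by omega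
    have i5 : r + 1 + m + 1 = r + m + 2 := by omega
    have e0 := auxQ.eq_3 v A (r + 1) (m + 1)
    have e1 := auxQ.eq_3 v A (r + 1) (m + 2)
    have e2 := auxQ.eq_3 v A r (m + 2)
    have e3 := auxQ.eq_3 v A (r + 2) m
    have e4 := auxQ.eq_3 v A (r + 1) m
    rw [i1] at e0
    rw [i2] at e1
    rw [i3] at e2
    rw [i4] at e3
    rw [i5] at e4
    simp only [Nat.succ_eq_add_one, add_assoc, Nat.reduceAdd] at ih hA hB e0 e1 e2 e3 e4 ⊢
    have key : ∀ x y : R, d * (x * y) - x * y * d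
      = (d * x - x * d) * y + x * (d * y - y * d) := by intro x y; noncomm_ring
    have k2 := key (A (r + (m + 3))) (A (r + 2))
    rw [hB, hA] at k2
    rw [e0]
    simp only [mul_add, add_mul, smul_mul_assoc, mul_smul_comm, mul_sub, sub_mul] at k2 ⊢
    linear_combination (norm := module) (1 + v) • k2 + v • ih - κ • (e1 - e2 + e3 - e4)

theorem auxC_formula (v : K) (A B : ℕ → R) :
    ∀ m r, (∀ k, k + 2 ≤ m → ∀ r, A r * A (r + k) - v • (A (r + k) * A r)
        = -auxS v B k + (v - 1) • auxQ v A k r) → 1 ≤ m →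
      auxC A m r = auxQ v A m r - auxU v B m
  | 0, r => by simp
  | 1, r => by simp [auxC, auxQ, auxU]
  | 2, r => by
    intro _ _
    simp only [auxC, auxQ, auxU, add_zero]
    module
  | (m + 3), r => by
    intro h _
    rw [auxC, auxQ, auxU, auxC_formula v A B (m + 1) (r + 1) (fun k hk => h k (by omega)) (by omega)]
    have := h (m + 1) (by omega) (r + 1)
    rw [auxS] at this
    have e : r + 1 + (m + 1) = r + m + 2 := by omega
    have e' : r + (m + 1) + 1 = r + m + 2 := by omega
    rw [e] at this
    rw [e']
    linear_combination (norm := module) this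

theorem main_abstract (v κ : K) (hκ : κ ≠ 0) (A B : ℕ → R) (n : ℕ)
    (hd : ∀ r, B 1 * A (r + 1) - A (r + 1) * B 1 = κ • (A (r + 2) - A r))
    (h1 : ∀ r, A r * A (r + 1) - v • (A (r + 1) * A r) = -B 1)
    (hB : ∀ m, 1 ≤ m → B m = -(A 0 * A m) + v • (A m * A 0) + (v - 1) • auxC A m 0)
    (hcom : ∀ k, 1 ≤ k → k < n → B 1 * B k - B k * B 1 = 0) :
    ∀ m, m ≤ n → ∀ r, A r * A (r + m) - v • (A (r + m) * A r)
        = -auxS v B m + (v - 1) • auxQ v A m r := by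
  have hU : ∀ m, m ≤ n + 1 → B 1 * auxU v B m - auxU v B m * B 1 = 0 := by
    intro m
    induction m using Nat.strong_induction_on with
    | _ m ih =>
      intro hm
      match m, ih, hm with
      | 0, _, _ => simp [auxU]
      | 1, _, _ => simp [auxU]
      | 2, _, _ => simp [auxU]
      | (m + 3), ih, hm =>
        have a := ih (m + 1) (by omega) (by omega)
        have b := hcom (m + 1) (by omega) (by omega)
        simp only [auxU, mul_add, add_mul, smul_mul_assoc, mul_smul_comm]
        linear_combination (norm := module) b + v • a
  have hS : ∀ m, m < n → B 1 * auxS v B m - auxS v B m * B 1 = 0 := by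
    intro m hm
    cases m with
    | zero => simp [auxS]
    | succ m =>
      have a := hU (m + 1) (by omega)
      have b := hcom (m + 1) (by omega) (by omega)
      simp only [auxS, mul_add, add_mul, smul_mul_assoc, mul_smul_comm]
      linear_combination (norm := module) b + (v - 1) • a
  intro m
  induction m using Nat.strong_induction_on with
  | _ m ih =>
    intro hm
    match m, ih, hm with
    | 0, _, _ =>
      intro r
      simp only [auxS, auxQ, add_zero]
      module
    | 1, _, _ =>
      intro r
      rw [h1]
      simp [auxS, auxQ, auxU]
    | (m + 2), ih, hm =>
      intro r
      induction r with
      | zero =>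
        have hC := auxC_formula v A B (m + 2) 0 (fun k hk => ih k (by omega) (by omega)) (by omega)
        have hb := hB (m + 2) (by omega)
        rw [hC] at hb
        simp only [auxS, zero_add]
        linear_combination (norm := module) hb
      | succ r ihr =>
        have f1 := ih (m + 1) (by omega) (by omega) (r + 1)
        have f2 := ih m (by omega) (by omega) (r + 1)
        have f3 := ih m (by omega) (by omega) (r + 2)
        have s1 := hS (m + 1) (by omega)
        have q1 := auxQ_der v κ A (B 1) hd h1 m r
        have dA := hd r
        have dB := hd (r + m + 1)
        have i1 : r + 1 + (m + 1) = r + m + 2 := by omega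
        have i2 : r + 1 + m = r + m + 1 := by omega
        have i3 : r + 2 + m = r + m + 2 := by omega
        have i4 : r + 1 + (m + 2) = r + m + 3 := by omega
        have i5 : r + (m + 2) = r + m + 2 := by omega
        rw [i1] at f1
        rw [i2] at f2
        rw [i3] at f3
        rw [i5] at ihr
        rw [i4]
        simp only [add_assoc, Nat.reduceAdd] at dA dB f1 f2 f3 ihr ⊢
        have key : ∀ x y : R, B 1 * (x * y) - x * y * B 1
          = (B 1 * x - x * B 1) * y + x * (B 1 * y - y * B 1) := by intro x y; noncomm_ring
        have k1 := key (A (r + 1)) (A (r + (m + 2)))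
        have k2 := key (A (r + (m + 2))) (A (r + 1))
        rw [dA, dB] at k1 k2
        have g1 := congrArg (fun x => B 1 * x - x * B 1) f1
        simp only [mul_add, add_mul, smul_mul_assoc, mul_smul_comm, mul_sub, sub_mul, mul_neg,
          neg_mul] at k1 k2 g1
        apply smul_right_injective R hκ
        simp only
        linear_combination (norm := module) κ • ihr - κ • f3 + κ • f2 + g1 - (k1 - v • k2)
          - s1 + (v - 1) • q1

end Abstract

section AbstractDG

variable {K R : Type*} [Field K] [Ring R] [Algebra K R]

/-- The formula for `T₀⁻¹(B₁)` inverts the formula for `T₀(B₁)`. -/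
theorem inv_abstract (q c : K) (hq : q ≠ 0) (hq2 : q ^ 2 + 1 ≠ 0) (hc : c ≠ 0) (x y X : R)
    (h : x ^ 3 * y - (q ^ 2 + 1 + (q⁻¹) ^ 2) • (x ^ 2 * y * x)
        + (q ^ 2 + 1 + (q⁻¹) ^ 2) • (x * y * x ^ 2) - y * x ^ 3
        = (-(q * c * (q + q⁻¹) ^ 2)) • (x * y - y * x))
    (hX : X = (q ^ 2 * (q + q⁻¹) * c)⁻¹ •
      (y * x ^ 2 - (q * (q + q⁻¹)) • (x * y * x) + q ^ 2 • (x ^ 2 * y)) + y) :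
    (q ^ 2 * (q + q⁻¹) * c)⁻¹ •
      (x ^ 2 * X - (q * (q + q⁻¹)) • (x * X * x) + q ^ 2 • (X * x ^ 2)) + X = y := by
  have ha : (q ^ 2 * (q + q⁻¹) * c)⁻¹ = (q * (q ^ 2 + 1) * c)⁻¹ := by
    congr 1
    field_simp
  have L := congrArg (fun z => x * z) h
  have M := congrArg (fun z => z * x) h
  rw [hX, ha]
  simp only [mul_add, add_mul, mul_sub, sub_mul, smul_mul_assoc, mul_smul_comm, pow_succ, pow_zero,
    one_mul, ← mul_assoc] at L M ⊢
  linear_combination (norm := (match_scalars <;> field_simp <;> ring))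
    (((q * (q ^ 2 + 1) * c)⁻¹) ^ 2 * q ^ 2) • L - (((q * (q ^ 2 + 1) * c)⁻¹) ^ 2 * q ^ 2) • M

/-- Invariance of `B_δ`. -/
theorem del_abstract (q c : K) (hq : q ≠ 0) (hq2 : q ^ 2 + 1 ≠ 0) (hc : c ≠ 0) (x y X : R)
    (h : y ^ 3 * x - (q ^ 2 + 1 + (q⁻¹) ^ 2) • (y ^ 2 * x * y)
        + (q ^ 2 + 1 + (q⁻¹) ^ 2) • (y * x * y ^ 2) - x * y ^ 3
        = (-(q * c * (q + q⁻¹) ^ 2)) • (y * x - x * y))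
    (hX : X = (q ^ 2 * (q + q⁻¹) * c)⁻¹ •
      (y ^ 2 * x - (q * (q + q⁻¹)) • (y * x * y) + q ^ 2 • (x * y ^ 2)) + x) :
    -(y * X) + ((q⁻¹) ^ 2) • (X * y) = -(x * y) + ((q⁻¹) ^ 2) • (y * x) := by
  have ha : (q ^ 2 * (q + q⁻¹) * c)⁻¹ = (q * (q ^ 2 + 1) * c)⁻¹ := by
    congr 1
    field_simp
  rw [hX, ha]
  simp only [mul_add, add_mul, mul_sub, sub_mul, smul_mul_assoc, mul_smul_comm, pow_succ, pow_zero,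
    one_mul, ← mul_assoc] at h ⊢
  linear_combination (norm := (match_scalars <;> field_simp <;> ring))
    (-(q * (q ^ 2 + 1) * c)⁻¹) • h

/-- The derivation `[B_δ, ·]` on `B₁`. -/
theorem der_abstract (q c : K) (hq : q ≠ 0) (hq2 : q ^ 2 + 1 ≠ 0) (hc : c ≠ 0) (x y X : R)
    (hX : X = (q ^ 2 * (q + q⁻¹) * c)⁻¹ •
      (y ^ 2 * x - (q * (q + q⁻¹)) • (y * x * y) + q ^ 2 • (x * y ^ 2)) + x) :
    (-(x * y) + ((q⁻¹) ^ 2) • (y * x)) * y - y * (-(x * y) + ((q⁻¹) ^ 2) • (y * x))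
      = (-(q + q⁻¹) * c) • (X - x) := by
  have ha : (q ^ 2 * (q + q⁻¹) * c)⁻¹ = (q * (q ^ 2 + 1) * c)⁻¹ := by
    congr 1
    field_simp
  rw [hX, ha]
  simp only [mul_add, add_mul, mul_sub, sub_mul, smul_mul_assoc, mul_smul_comm, pow_succ, pow_zero,
    one_mul, ← mul_assoc, neg_mul, mul_neg]
  match_scalars <;> field_simp <;> ring

end AbstractDG

theorem qq_ne : qq ≠ 0 := RatFunc.X_ne_zero

theorem qq_sq_ne : qq ^ 2 + 1 ≠ 0 := by
  have h : (qq ^ 2 + 1 : KK) = algebraMap (Polynomial ℚ) KK (Polynomial.X ^ 2 + 1) := by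
    simp [qq, RatFunc.algebraMap_X]
  rw [h]
  apply RatFunc.algebraMap_ne_zero
  intro h0
  have := congrArg (Polynomial.eval 0) h0
  simp at this

theorem qq_add_ne : qq + qq⁻¹ ≠ 0 := by
  intro h
  apply qq_sq_ne
  have h2 := congrArg (fun x => x * qq) h
  simp only [add_mul, inv_mul_cancel₀ qq_ne, zero_mul] at h2
  rw [pow_two]
  exact h2

theorem dg0 (c : KK) : Bo c ^ 3 * Bi c
        - (qq ^ 2 + 1 + (qq⁻¹) ^ 2) • (Bo c ^ 2 * Bi c * Bo c)
        + (qq ^ 2 + 1 + (qq⁻¹) ^ 2) • (Bo c * Bi c * Bo c ^ 2)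
        - Bi c * Bo c ^ 3 = (-(qq * c * (qq + qq⁻¹) ^ 2)) • (Bo c * Bi c - Bi c * Bo c) := by
  have h := RingQuot.mkAlgHom_rel KK (qOnsRel.r0 (c := c))
  simp only [map_add, map_sub, map_mul, map_smul, map_pow] at h
  exact h

theorem dg1 (c : KK) : Bi c ^ 3 * Bo c
        - (qq ^ 2 + 1 + (qq⁻¹) ^ 2) • (Bi c ^ 2 * Bo c * Bi c)
        + (qq ^ 2 + 1 + (qq⁻¹) ^ 2) • (Bi c * Bo c * Bi c ^ 2)
        - Bo c * Bi c ^ 3 = (-(qq * c * (qq + qq⁻¹) ^ 2)) • (Bi c * Bo c - Bo c * Bi c) := by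
  have h := RingQuot.mkAlgHom_rel KK (qOnsRel.r1 (c := c))
  simp only [map_add, map_sub, map_mul, map_smul, map_pow] at h
  exact h

theorem T0_inv_val (c : KK) (hc : c ≠ 0) (T0 : QOns c ≃ₐ[KK] QOns c)
    (hT00 : T0 (Bo c) = Bo c) (hT01 : T0 (Bi c) = T0B1val c) :
    T0 (T0invB1val c) = Bi c := by
  have h := inv_abstract qq c qq_ne qq_sq_ne hc (Bo c) (Bi c) (T0B1val c) (dg0 c) rfl
  unfold T0invB1val
  simp only [map_add, map_sub, map_mul, map_smul, map_pow, hT00, hT01]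
  exact h

section Concrete

variable (c : KK) (Φ T0 : QOns c ≃ₐ[KK] QOns c)

/-- The automorphism `T₁⁻¹Φ`. -/
def tau : QOns c ≃ₐ[KK] QOns c := Φ.trans (T1def c Φ T0).symm

/-- The real root vectors shifted by one, starting at `B₀`. -/
def AA (n : ℕ) : QOns c := (⇑(tau c Φ T0))^[n] (Bo c)

theorem AA_succ (n : ℕ) : AA c Φ T0 (n + 1) = tau c Φ T0 (AA c Φ T0 n) :=
  Function.iterate_succ_apply' _ _ _

/-- The explicit formula for `B_{δ+α₁}`. -/
def A2val : QOns c := (qq ^ 2 * (qq + qq⁻¹) * c)⁻¹ •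
    (Bi c ^ 2 * Bo c - (qq * (qq + qq⁻¹)) • (Bi c * Bo c * Bi c) + qq ^ 2 • (Bo c * Bi c ^ 2))
    + Bo c

variable {c Φ T0}

theorem T1_apply (z : QOns c) : T1def c Φ T0 z = Φ (T0 (Φ z)) := rfl

theorem tau_apply (z : QOns c) : tau c Φ T0 z = (T1def c Φ T0).symm (Φ z) := rfl

theorem tau_Bo (hΦ0 : Φ (Bo c) = Bi c) (hΦ1 : Φ (Bi c) = Bo c) (hT00 : T0 (Bo c) = Bo c) :
    tau c Φ T0 (Bo c) = Bi c := by
  rw [tau_apply, AlgEquiv.symm_apply_eq, T1_apply, hΦ1, hT00]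

theorem tau_Bi (hc : c ≠ 0) (hΦ0 : Φ (Bo c) = Bi c) (hΦ1 : Φ (Bi c) = Bo c)
    (hT00 : T0 (Bo c) = Bo c) (hT01 : T0 (Bi c) = T0B1val c) :
    tau c Φ T0 (Bi c) = A2val c := by
  rw [tau_apply, AlgEquiv.symm_apply_eq, T1_apply, hΦ1]
  have h : Φ (A2val c) = T0invB1val c := by
    unfold A2val T0invB1val
    simp only [map_add, map_sub, map_mul, map_smul, map_pow, hΦ0, hΦ1]
  rw [h, T0_inv_val c hc T0 hT00 hT01, hΦ1]

theorem AA_eq (hΦ0 : Φ (Bo c) = Bi c) (hΦ1 : Φ (Bi c) = Bo c) (hT00 : T0 (Bo c) = Bo c) (n : ℕ) :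
    AA c Φ T0 (n + 1) = Ba1 c Φ T0 n := by
  unfold AA
  rw [Function.iterate_succ_apply, tau_Bo hΦ0 hΦ1 hT00]
  rfl

end Concrete

/-- `q⁻²`-commutators of real root vectors. -/
theorem stmt14 (c : KK) (hc : c ≠ 0) (Φ T0 : QOns c ≃ₐ[KK] QOns c)
    (hΦ0 : Φ (Bo c) = Bi c) (hΦ1 : Φ (Bi c) = Bo c)
    (hT00 : T0 (Bo c) = Bo c) (hT01 : T0 (Bi c) = T0B1val c)
    (n : ℕ) (hn : 1 ≤ n)
    (hcom : ∀ k, 1 ≤ k → k < n → Bdel c * Bim c Φ T0 (k) - Bim c Φ T0 (k) * Bdel c = 0) :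
    ∀ m r : ℕ, 1 ≤ m → m ≤ n →
      Ba1 c Φ T0 (r) * Ba1 c Φ T0 (r + m) - ((qq⁻¹) ^ 2) • (Ba1 c Φ T0 (r + m) * Ba1 c Φ T0 (r)) =
        -Bim c Φ T0 (m)
        - ((qq⁻¹) ^ 2 - 1) •
            (∑ p ∈ Finset.Icc 1 ((m - 1) / 2), (qq⁻¹) ^ (2 * (p - 1)) • Bim c Φ T0 (m - 2 * p))
        + ((qq⁻¹) ^ 2 - 1) •
            (∑ p ∈ Finset.Icc 1 (m / 2),
              (if 2 * p = m then (qq⁻¹) ^ (m - 2) else (qq⁻¹) ^ (2 * (p - 1)) * (1 + (qq⁻¹) ^ 2)) • (Ba1 c Φ T0 (m - p + r) * Ba1 c Φ T0 (p + r))) := by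
  have hAA := AA_eq hΦ0 hΦ1 hT00
  have hAA0 : AA c Φ T0 0 = Bo c := rfl
  have hAA1 : AA c Φ T0 1 = Bi c := tau_Bo hΦ0 hΦ1 hT00
  have hAA2 : AA c Φ T0 2 = A2val c := by
    rw [AA_succ, hAA1, tau_Bi hc hΦ0 hΦ1 hT00 hT01]
  have hB1 : Bim c Φ T0 1 = Bdel c := by
    have : Ba1 c Φ T0 0 = Bi c := rfl
    simp [Bim, CC, Bdel, this]
  have htd : tau c Φ T0 (Bdel c) = Bdel c := by
    have h := del_abstract qq c qq_ne qq_sq_ne hc (Bo c) (Bi c) (A2val c) (dg1 c) rfl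
    unfold Bdel
    simp only [map_add, map_neg, map_mul, map_smul, tau_Bo hΦ0 hΦ1 hT00,
      tau_Bi hc hΦ0 hΦ1 hT00 hT01]
    exact h
  have hd : ∀ r, Bdel c * AA c Φ T0 (r + 1) - AA c Φ T0 (r + 1) * Bdel c
      = (-(qq + qq⁻¹) * c) • (AA c Φ T0 (r + 2) - AA c Φ T0 r) := by
    intro r
    induction r with
    | zero =>
      have h := der_abstract qq c qq_ne qq_sq_ne hc (Bo c) (Bi c) (A2val c) rfl
      rw [zero_add, zero_add, hAA0, hAA1, hAA2]
      exact h
    | succ r ih =>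
      have h := congrArg (tau c Φ T0) ih
      simp only [map_sub, map_mul, map_smul, htd, ← AA_succ] at h
      exact h
  have h1 : ∀ r, AA c Φ T0 r * AA c Φ T0 (r + 1)
      - (qq⁻¹ ^ 2) • (AA c Φ T0 (r + 1) * AA c Φ T0 r) = -Bdel c := by
    intro r
    induction r with
    | zero =>
      rw [zero_add, hAA0, hAA1, Bdel, neg_add, neg_neg, sub_eq_add_neg]
    | succ r ih =>
      have h := congrArg (tau c Φ T0) ih
      simp only [map_sub, map_mul, map_smul, map_neg, htd, ← AA_succ] at h
      exact h
  have hκ : -(qq + qq⁻¹) * c ≠ 0 := mul_ne_zero (neg_ne_zero.mpr qq_add_ne) hc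
  rw [← hB1] at hcom hd h1
  have hB : ∀ m, 1 ≤ m → Bim c Φ T0 m = -(AA c Φ T0 0 * AA c Φ T0 m)
      + (qq⁻¹ ^ 2) • (AA c Φ T0 m * AA c Φ T0 0)
      + (qq⁻¹ ^ 2 - 1) • auxC (AA c Φ T0) m 0 := by
    intro m hm
    obtain ⟨k, rfl⟩ : ∃ k, m = k + 1 := ⟨m - 1, by omega⟩
    rw [auxC_eq_sum, hAA0]
    simp only [zero_add, hAA, Bim, CC, Nat.add_sub_cancel]
  have main := main_abstract (qq⁻¹ ^ 2) _ hκ (AA c Φ T0) (Bim c Φ T0) n hd h1 hB hcom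
  intro m r hm hmn
  have h := main m hmn (r + 1)
  obtain ⟨k, rfl⟩ : ∃ k, m = k + 1 := ⟨m - 1, by omega⟩
  rw [auxS, auxU_eq_sum, auxQ_eq_sum _ _ _ _ hm] at h
  have i1 : r + 1 + (k + 1) = r + (k + 1) + 1 := by omega
  rw [i1, hAA, hAA] at h
  rw [h, neg_add, ← sub_eq_add_neg]
  have hI : ∀ (N : ℕ) (f : ℕ → QOns c),
      ∑ p ∈ Finset.Icc 1 N, f p = ∑ p ∈ Finset.range N, f (p + 1) := by
    intro N f
    rw [Finset.range_eq_Ico, Finset.sum_Ico_add' f 0 N 1]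
    rfl
  rw [hI, hI]
  congr 2
  · congr 1
    apply Finset.sum_congr rfl
    intro p _
    rw [Nat.add_sub_cancel, pow_mul]
  · apply Finset.sum_congr rfl
    intro p _
    rw [← add_assoc, ← add_assoc, hAA, hAA, Nat.add_sub_cancel, pow_mul]
    congr 1
    split_ifs with hp
    · rw [← hp, ← pow_mul]
      congr 1
    · rfl

end
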